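/- (Theorem 1.4, in N variables, with monomial positivity.) Let λ^1,…,λ^r be partitions and N ≥ 1. Then the polynomial Σ_{π ∈ 𝒫([r])} (−1)^{#π−1}(#π−1)! Π_{B∈π} H̃_{λ^B}^{(N)} is divisible by (q−1)^{r−1} in ℤ[q,t,x_1,…,x_N], and moreover the quotient by (q−1)^{r−1} is a polynomial with nonnegative integer coefficients. -/

import Mathlib

open Finset

open scoped Classical

noncomputable section

/-! ### Set partitions -/

/-- `π` is a set partition of the finite set `H`. -/
def IsSetPartition {α : Type*} (π : Finset (Finset α)) (H : Finset α) : Prop :=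
  (∀ B ∈ π, B ⊆ H) ∧ (∀ B ∈ π, B.Nonempty) ∧
    (∀ B ∈ π, ∀ C ∈ π, B ≠ C → Disjoint B C) ∧ (∀ a ∈ H, ∃ B ∈ π, a ∈ B)

/-- The finite set of all set partitions of `H`. -/
def setPartitions {α : Type*} (H : Finset α) : Finset (Finset (Finset α)) :=
  H.powerset.powerset.filter (fun π => IsSetPartition π H)

/-- The joint cumulant of the family `u` on the subset `H`. -/
def jointCumulant {A : Type*} [CommRing A] {ι : Type*} (u : Finset ι → A) (H : Finset ι) : A :=
  ∑ π ∈ setPartitions H,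
    (-1 : A) ^ (π.card - 1) * ((π.card - 1).factorial : A) * ∏ B ∈ π, u B

/-! ### Multigraphs -/

/-- Number of edges of the multigraph with endpoint map `ends` whose endpoint set is `{i,j}`. -/
def eCnt {V E : Type*} [Fintype E] (ends : E → Sym2 V) (i j : V) : ℕ :=
  (univ.filter fun e => ends e = s(i, j)).card

/-- The spanning subgraph `(V, S)` is connected. -/
def SConnected {V E : Type*} (ends : E → Sym2 V) (S : Finset E) : Prop :=
  ∀ v w : V, Relation.ReflTransGen (fun a b => ∃ e ∈ S, ends e = s(a, b)) v w

/-- The subgraph `(B, S)` is connected. -/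
def SConnectedOn {V E : Type*} (ends : E → Sym2 V) (B : Finset V) (S : Finset E) : Prop :=
  ∀ v ∈ B, ∀ w ∈ B, Relation.ReflTransGen (fun a b => ∃ e ∈ S, ends e = s(a, b)) v w

/-- `E|_B`: the edges with both endpoints in `B`. -/
def edgesIn {V E : Type*} [Fintype E] (ends : E → Sym2 V) (B : Finset V) : Finset E :=
  univ.filter fun e => ∀ v ∈ ends e, v ∈ B

/-- `c_{G|_B}(q) = Σ_{S ⊆ E|_B, (B,S) connected} q^{#S}` as a polynomial in `q`. -/
def connPoly {V E : Type*} [Fintype E] (ends : E → Sym2 V) (B : Finset V) : Polynomial ℤ :=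
  ∑ S ∈ (edgesIn ends B).powerset.filter (fun S => SConnectedOn ends B S),
    Polynomial.X ^ S.card

/-- Number of edges joining `w` to some vertex of `B`. -/
def dCnt {V E : Type*} [Fintype E] (ends : E → Sym2 V) (B : Finset V) (w : V) : ℕ :=
  (univ.filter fun e => ∃ b ∈ B, ends e = s(w, b)).card

/-! ### The `G`-inversion polynomial -/

/-- `[m]_q = 1 + q + ⋯ + q^{m-1}`. -/
def nq {R : Type*} [CommSemiring R] (q : R) (m : ℕ) : R := ∑ k ∈ Finset.range m, q ^ k

/-- Rooted spanning trees (encoded by parent maps, rooted at `0`) of the simple graph `G̃`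
underlying the multigraph on `Fin (r+1)` with edge multiplicities `e`. -/
def parentMaps {r : ℕ} (e : Fin (r+1) → Fin (r+1) → ℕ) : Finset (Fin (r+1) → Fin (r+1)) :=
  univ.filter fun p => p 0 = 0 ∧ (∀ w, w ≠ 0 → p w ≠ w ∧ 0 < e w (p w)) ∧ ∀ w, ∃ k, p^[k] w = 0

/-- `(i,j)` is a `κ`-inversion of the spanning tree encoded by `p`. -/
def isKappaInv {r : ℕ} (e : Fin (r+1) → Fin (r+1) → ℕ) (p : Fin (r+1) → Fin (r+1))
    (i j : Fin (r+1)) : Prop :=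
  i ≠ 0 ∧ j ≠ 0 ∧ i ≠ j ∧ (∃ k, p^[k] j = i) ∧ j < i ∧ p i ≠ j ∧ 0 < e j (p i)

/-- `κ(T) = Σ_{(i,j) κ-inversion} e_{parent(i), j}`. -/
def kappaStat {r : ℕ} (e : Fin (r+1) → Fin (r+1) → ℕ) (p : Fin (r+1) → Fin (r+1)) : ℕ :=
  ∑ pr ∈ (univ ×ˢ univ : Finset (Fin (r+1) × Fin (r+1))).filter
    (fun pr => isKappaInv e p pr.1 pr.2), e (p pr.1) pr.2

/-- `δ_T(w) = Σ_u e_{u, parent(w)}`, `u` ranging over descendants of `w` together with `w`. -/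
def deltaStat {r : ℕ} (e : Fin (r+1) → Fin (r+1) → ℕ) (p : Fin (r+1) → Fin (r+1))
    (w : Fin (r+1)) : ℕ :=
  ∑ u ∈ univ.filter (fun u => ∃ k, p^[k] u = w), e u (p w)

/-- The `G`-inversion polynomial `𝓘_G(q)` of the multigraph on `Fin (r+1)` with
edge multiplicities `e`, evaluated at an element `q` of a commutative (semi)ring. -/
def Iinv {r : ℕ} {R : Type*} [CommSemiring R] (e : Fin (r+1) → Fin (r+1) → ℕ) (q : R) : R :=
  q ^ (∑ i, e i i) *
    ∑ p ∈ parentMaps e, q ^ kappaStat e p * ∏ w ∈ univ.erase (0 : Fin (r+1)), nq q (e w (p w))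

/-! ### Partitions, Young diagrams and fillings -/

/-- `f : ℕ → ℕ` encodes a partition: `f j` is the `j`-th part (for `j ≥ 1`). -/
def IsPartitionFun (f : ℕ → ℕ) : Prop := Antitone f ∧ ∃ N, f N = 0

/-- The number of (nonempty) rows of the diagram of `f`. -/
def nRows (f : ℕ → ℕ) : ℕ := sSup {j | f j ≠ 0}

/-- `λ^t_i`: the length of the `i`-th column of the diagram of `f`. -/
def colLen (f : ℕ → ℕ) (i : ℕ) : ℕ :=
  ((Finset.Icc 1 (nRows f)).filter (fun j => i ≤ f j)).card

/-- The cells `(i,j)`, `1 ≤ i ≤ f j`, `j ≥ 1`, of the Young diagram of `f`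
(French convention, `i` the column index and `j` the row index). -/
def cells (f : ℕ → ℕ) : Finset (ℕ × ℕ) :=
  (Finset.Icc 1 (f 1) ×ˢ Finset.Icc 1 (nRows f)).filter (fun c => c.1 ≤ f c.2)

/-- Fillings of the diagram of `f` with entries in `{1, …, N}`, encoded as functions
`ℕ × ℕ → ℕ` vanishing outside the diagram. -/
def fillings (f : ℕ → ℕ) (N : ℕ) : Finset ((ℕ × ℕ) → ℕ) :=
  ((cells f).pi (fun _ => Finset.Icc 1 N)).image
    (fun g c => if h : c ∈ cells f then g c h else 0)

/-- The descent set of a filling. -/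
def desSet (f : ℕ → ℕ) (σ : (ℕ × ℕ) → ℕ) : Finset (ℕ × ℕ) :=
  (cells f).filter (fun c => 2 ≤ c.2 ∧ σ (c.1, c.2 - 1) < σ c)

/-- `maj(σ) = Σ_{□ ∈ Des(σ)} (leg(□) + 1)`. -/
def majStat (f : ℕ → ℕ) (σ : (ℕ × ℕ) → ℕ) : ℕ :=
  ∑ c ∈ desSet f σ, (colLen f c.1 - c.2 + 1)

/-- The counterclockwise-increasing condition defining inversion pairs; the box below `c1`
is read via `σ`, which vanishes off the diagram (giving the convention `σ(□_3) = 0`). -/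
def invTriple (σ : (ℕ × ℕ) → ℕ) (c1 c2 : ℕ × ℕ) : Prop :=
  (σ c1 ≤ σ (c1.1, c1.2 - 1) ∧ σ (c1.1, c1.2 - 1) < σ c2) ∨
  (σ (c1.1, c1.2 - 1) < σ c2 ∧ σ c2 < σ c1) ∨
  (σ c2 < σ c1 ∧ σ c1 ≤ σ (c1.1, c1.2 - 1))

/-- The set of inversion pairs of a filling. -/
def invPairs (f : ℕ → ℕ) (σ : (ℕ × ℕ) → ℕ) : Finset ((ℕ × ℕ) × (ℕ × ℕ)) :=
  ((cells f) ×ˢ (cells f)).filter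
    (fun pr => pr.1.2 = pr.2.2 ∧ pr.1.1 < pr.2.1 ∧ invTriple σ pr.1 pr.2)

/-- `inv(σ)`: the number of inversion pairs. -/
def invStat (f : ℕ → ℕ) (σ : (ℕ × ℕ) → ℕ) : ℕ := (invPairs f σ).card

/-! ### The ring `ℤ[q, t, x₁, x₂, …]` and Macdonald polynomials -/

/-- The polynomial ring `ℤ[q, t, x₀, x₁, x₂, …]`. -/
abbrev MR : Type := MvPolynomial (Fin 2 ⊕ ℕ) ℤ

/-- The variable `q`. -/
def qv : MR := MvPolynomial.X (Sum.inl 0)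

/-- The variable `t`. -/
def tv : MR := MvPolynomial.X (Sum.inl 1)

/-- The variable `x_k`. -/
def xv (k : ℕ) : MR := MvPolynomial.X (Sum.inr k)

/-- Haglund's formula: the modified Macdonald polynomial in the variables `x_1, …, x_N`. -/
def macH (f : ℕ → ℕ) (N : ℕ) : MR :=
  ∑ σ ∈ fillings f N, qv ^ invStat f σ * tv ^ majStat f σ * ∏ c ∈ cells f, xv (σ c)

/-- `λ^B = ⊕_{b ∈ B} λ^b`. -/
def lamB {r : ℕ} (lam : Fin (r+1) → ℕ → ℕ) (B : Finset (Fin (r+1))) : ℕ → ℕ :=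
  fun j => ∑ b ∈ B, lam b j

/-- The (unnormalized) Macdonald cumulant
`Σ_{π ∈ 𝒫([r])} (-1)^{#π-1} (#π-1)! Π_{B ∈ π} H̃_{λ^B}`. -/
def macCumulant {r : ℕ} (lam : Fin (r+1) → ℕ → ℕ) (N : ℕ) : MR :=
  ∑ π ∈ setPartitions (univ : Finset (Fin (r+1))),
    (-1 : MR) ^ (π.card - 1) * ((π.card - 1).factorial : MR) * ∏ B ∈ π, macH (lamB lam B) N

/-! ### Coloring of the diagram `λ^B` -/

/-- Labels `(b, i)`, `b ∈ B`, `1 ≤ i ≤ λ^b_1`, of the columns of the diagrams `λ^b`, `b ∈ B`. -/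
def columnPairs {r : ℕ} (lam : Fin (r+1) → ℕ → ℕ) (B : Finset (Fin (r+1))) :
    Finset (Fin (r+1) × ℕ) :=
  (B ×ˢ Finset.Icc 1 (lamB lam B 1)).filter (fun p => p.2 ≤ lam p.1 1)

/-- The column `p'` comes weakly before the column `p` in the sorted order
(longer first; ties first by color, then by column index). -/
def colBefore {r : ℕ} (lam : Fin (r+1) → ℕ → ℕ) (p' p : Fin (r+1) × ℕ) : Prop :=
  colLen (lam p.1) p.2 < colLen (lam p'.1) p'.2 ∨
    (colLen (lam p'.1) p'.2 = colLen (lam p.1) p.2 ∧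
      (p'.1 < p.1 ∨ (p'.1 = p.1 ∧ p'.2 ≤ p.2)))

/-- The position in `λ^B` of the column `i` of `λ^b`. -/
def posIn {r : ℕ} (lam : Fin (r+1) → ℕ → ℕ) (B : Finset (Fin (r+1)))
    (b : Fin (r+1)) (i : ℕ) : ℕ :=
  ((columnPairs lam B).filter (fun p' => colBefore lam p' (b, i))).card

/-- The label `(b, i)` of the column of `λ^B` at position `c`. -/
def colAt {r : ℕ} (lam : Fin (r+1) → ℕ → ℕ) (B : Finset (Fin (r+1))) (c : ℕ) :
    Fin (r+1) × ℕ :=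
  if h : ∃ p ∈ columnPairs lam B, posIn lam B p.1 p.2 = c then h.choose else (0, 1)

/-- The filling `σ^B` of `λ^B` induced from a filling `σ` of `λ^{[r]}` via the
identification of boxes given by the coloring. -/
def inducedFilling {r : ℕ} (lam : Fin (r+1) → ℕ → ℕ) (B : Finset (Fin (r+1)))
    (σ : (ℕ × ℕ) → ℕ) : (ℕ × ℕ) → ℕ :=
  fun cj =>
    if ∃ p ∈ columnPairs lam B, posIn lam B p.1 p.2 = cj.1 then
      σ (posIn lam univ (colAt lam B cj.1).1 (colAt lam B cj.1).2, cj.2)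
    else 0

/-- The color of the column `x` of `λ^{[r]}`. -/
def colColor {r : ℕ} (lam : Fin (r+1) → ℕ → ℕ) (x : ℕ) : Fin (r+1) :=
  (colAt lam univ x).1

/-- Edge multiplicities of the multigraph `G^σ`: the number of inversion pairs of `σ`
colored by `{i, j}`. -/
def eG {r : ℕ} (lam : Fin (r+1) → ℕ → ℕ) (σ : (ℕ × ℕ) → ℕ) (i j : Fin (r+1)) : ℕ :=
  ((invPairs (lamB lam univ) σ).filter (fun pr =>
    (colColor lam pr.1.1 = i ∧ colColor lam pr.2.1 = j) ∨
    (colColor lam pr.1.1 = j ∧ colColor lam pr.2.1 = i))).card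

/-- Edge multiplicities of the multigraph `G^{□_1,…,□_s}` attached to a set `D` of boxes:
for each box of `D` and each box strictly to its left in the same row, one edge joining
the colors of the two columns. -/
def eBox {r : ℕ} (lam : Fin (r+1) → ℕ → ℕ) (D : Finset (ℕ × ℕ)) (i j : Fin (r+1)) : ℕ :=
  ((D ×ˢ cells (lamB lam univ)).filter (fun pr =>
    pr.2.2 = pr.1.2 ∧ pr.2.1 < pr.1.1 ∧
      ((colColor lam pr.2.1 = i ∧ colColor lam pr.1.1 = j) ∨
       (colColor lam pr.2.1 = j ∧ colColor lam pr.1.1 = i)))).card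


/-! ### Cumulants of graph weights -/

lemma mem_setPartitions {α : Type*} {π : Finset (Finset α)} {H : Finset α} :
    π ∈ setPartitions H ↔ IsSetPartition π H := by
  simp only [setPartitions, mem_filter, mem_powerset, and_iff_right_iff_imp]
  intro h B hB
  exact mem_powerset.2 (h.1 B hB)

/-- Every set partition of `insert b H` arises uniquely by adding `b` to a block, or to the empty
set, of a set partition of `H`. -/
lemma sum_setPartitions_insert {α M : Type*} [AddCommMonoid M] {H : Finset α} {b : α}
    (hb : b ∉ H) (F : Finset (Finset α) → M) :
    ∑ π ∈ setPartitions (insert b H), F π =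
      ∑ π ∈ setPartitions H, ∑ C ∈ insert ∅ π, F (insert (insert b C) (π.erase C)) := by
  have key : ∀ π ∈ setPartitions H, (∀ C ∈ insert ∅ π, b ∉ C) ∧ ∅ ∉ π := by
    intro π hπ
    rw [mem_setPartitions] at hπ
    refine ⟨fun C hC hbC => ?_, fun h => by simpa using hπ.2.1 _ h⟩
    rcases mem_insert.1 hC with rfl | h
    · simp at hbC
    · exact hb (hπ.1 C h hbC)
  rw [sum_sigma']
  symm
  refine sum_bij (fun x _ => insert (insert b x.2) (x.1.erase x.2)) ?_ ?_ ?_ (fun _ _ => rfl)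
  · rintro ⟨π, C⟩ h
    simp only [mem_sigma] at h
    obtain ⟨hπ, hC⟩ := h
    obtain ⟨hk, -⟩ := key π hπ
    rw [mem_setPartitions] at hπ ⊢
    obtain ⟨h1, h2, h3, h4⟩ := hπ
    have hCd : ∀ D ∈ π, D ≠ C → Disjoint C D := by
      intro D hD hne
      rcases mem_insert.1 hC with rfl | h
      · simp
      · exact h3 C h D hD hne.symm
    have hCH : C ⊆ H := by
      rcases mem_insert.1 hC with rfl | h
      · simp
      · exact h1 C h
    refine ⟨?_, ?_, ?_, ?_⟩
    · intro B hB
      rcases mem_insert.1 hB with rfl | h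
      · exact insert_subset_insert _ hCH
      · exact (h1 B (mem_of_mem_erase h)).trans (subset_insert _ _)
    · intro B hB
      rcases mem_insert.1 hB with rfl | h
      · simp
      · exact h2 B (mem_of_mem_erase h)
    · intro B hB D hD hne
      rcases mem_insert.1 hB with rfl | h <;> rcases mem_insert.1 hD with rfl | h'
      · exact absurd rfl hne
      · rw [mem_erase] at h'
        rw [disjoint_insert_left]
        exact ⟨hk D (mem_insert_of_mem h'.2), hCd D h'.2 h'.1⟩
      · rw [mem_erase] at h
        rw [disjoint_insert_right]
        exact ⟨hk B (mem_insert_of_mem h.2), (hCd B h.2 h.1).symm⟩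
      · exact h3 B (mem_of_mem_erase h) D (mem_of_mem_erase h') hne
    · intro a ha
      rcases mem_insert.1 ha with rfl | h
      · exact ⟨_, mem_insert_self _ _, mem_insert_self _ _⟩
      · obtain ⟨B, hB, haB⟩ := h4 a h
        by_cases hBC : B = C
        · exact ⟨_, mem_insert_self _ _, mem_insert_of_mem (hBC ▸ haB)⟩
        · exact ⟨B, mem_insert_of_mem (mem_erase.2 ⟨hBC, hB⟩), haB⟩
  · rintro ⟨π, C⟩ h ⟨π', C'⟩ h' heq
    simp only [mem_sigma] at h h' heq
    obtain ⟨hk, h0⟩ := key π h.1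
    obtain ⟨hk', h0'⟩ := key π' h'.1
    have hnot : insert b C ∉ π.erase C := fun hm =>
      hk _ (mem_insert_of_mem (mem_of_mem_erase hm)) (mem_insert_self _ _)
    have hnot' : insert b C' ∉ π'.erase C' := fun hm =>
      hk' _ (mem_insert_of_mem (mem_of_mem_erase hm)) (mem_insert_self _ _)
    have hCC : insert b C = insert b C' := by
      have : insert b C ∈ insert (insert b C') (π'.erase C') := heq ▸ mem_insert_self _ _
      rcases mem_insert.1 this with h1 | h1
      · exact h1
      · exact absurd (mem_insert_self _ _) (hk' _ (mem_insert_of_mem (mem_of_mem_erase h1)))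
    have hC : C = C' := by
      rw [← erase_insert (hk C h.2), hCC, erase_insert (hk' C' h'.2)]
    subst hC
    have he : π.erase C = π'.erase C := by
      rw [← erase_insert hnot, heq, erase_insert hnot']
    have hπ : π = π' := by
      by_cases hC0 : C = ∅
      · subst hC0
        rwa [erase_eq_of_notMem h0, erase_eq_of_notMem h0'] at he
      · have h1 := (mem_insert.1 h.2).resolve_left hC0
        have h2 := (mem_insert.1 h'.2).resolve_left hC0
        rw [← insert_erase h1, he, insert_erase h2]
    rw [hπ]
  · intro ρ hρ
    rw [mem_setPartitions] at hρ
    obtain ⟨h1, h2, h3, h4⟩ := hρ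
    obtain ⟨D, hD, hbD⟩ := h4 b (mem_insert_self _ _)
    have hbn : ∀ B ∈ ρ, B ≠ D → b ∉ B := fun B hB hne hbB =>
      disjoint_left.1 (h3 B hB D hD hne) hbB hbD
    have hDn : D.erase b ∉ ρ.erase D := by
      intro hm
      obtain ⟨x, hx⟩ := h2 _ (mem_of_mem_erase hm)
      exact disjoint_left.1 (h3 _ (mem_of_mem_erase hm) D hD (ne_of_mem_erase hm)) hx
        (mem_of_mem_erase hx)
    have h0 : ∅ ∉ ρ.erase D := fun hm => by simpa using h2 _ (mem_of_mem_erase hm)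
    have hsub : ∀ B ∈ ρ, B.erase b ⊆ H := fun B hB x hx =>
      (mem_insert.1 (h1 B hB (mem_of_mem_erase hx))).resolve_left (ne_of_mem_erase hx)
    refine ⟨⟨(insert (D.erase b) (ρ.erase D)).erase ∅, D.erase b⟩, ?_, ?_⟩
    · simp only [mem_sigma]
      constructor
      · rw [mem_setPartitions]
        refine ⟨?_, ?_, ?_, ?_⟩
        · intro B hB
          rcases mem_insert.1 (mem_of_mem_erase hB) with rfl | h
          · exact hsub D hD
          · rw [mem_erase] at h
            rw [← erase_eq_of_notMem (hbn B h.2 h.1)]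
            exact hsub B h.2
        · intro B hB
          exact nonempty_iff_ne_empty.2 (ne_of_mem_erase hB)
        · intro B hB B' hB' hne
          rcases mem_insert.1 (mem_of_mem_erase hB) with rfl | h <;>
            rcases mem_insert.1 (mem_of_mem_erase hB') with rfl | h'
          · exact absurd rfl hne
          · rw [mem_erase] at h'
            exact (h3 D hD B' h'.2 h'.1.symm).mono_left (erase_subset _ _)
          · rw [mem_erase] at h
            exact (h3 B h.2 D hD h.1).mono_right (erase_subset _ _)
          · exact h3 B (mem_of_mem_erase h) B' (mem_of_mem_erase h') hne
        · intro a ha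
          have hab : a ≠ b := fun h => hb (h ▸ ha)
          obtain ⟨B, hB, haB⟩ := h4 a (mem_insert_of_mem ha)
          by_cases hBD : B = D
          · have haD : a ∈ D.erase b := mem_erase.2 ⟨hab, hBD ▸ haB⟩
            exact ⟨_, mem_erase.2 ⟨ne_empty_of_mem haD, mem_insert_self _ _⟩, haD⟩
          · exact ⟨B, mem_erase.2 ⟨ne_empty_of_mem haB,
              mem_insert_of_mem (mem_erase.2 ⟨hBD, hB⟩)⟩, haB⟩
      · by_cases hE : D.erase b = ∅
        · simp [hE]
        · exact mem_insert_of_mem (mem_erase.2 ⟨hE, mem_insert_self _ _⟩)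
    · simp only
      rw [erase_right_comm, erase_insert hDn, erase_eq_of_notMem h0, insert_erase hbD,
        insert_erase hD]

lemma setPartitions_singleton {α : Type*} (a : α) : setPartitions {a} = {{{a}}} := by
  ext π
  rw [mem_setPartitions, mem_singleton]
  constructor
  · rintro ⟨h1, h2, -, h4⟩
    have hB : ∀ B ∈ π, B = {a} := fun B hB =>
      (subset_singleton_iff.1 (h1 B hB)).resolve_left (h2 B hB).ne_empty
    obtain ⟨B, hBπ, -⟩ := h4 a (mem_singleton_self a)
    ext C
    rw [mem_singleton]
    exact ⟨hB C, fun h => h ▸ hB B hBπ ▸ hBπ⟩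
  · rintro rfl
    simp [IsSetPartition]

/-- The cumulants of the constant family `1` vanish on sets with at least two elements. -/
lemma jointCumulant_one_insert {α A : Type*} [CommRing A] {H : Finset α} {b : α} (hb : b ∉ H)
    (hH : H.Nonempty) : jointCumulant (fun _ => (1 : A)) (insert b H) = 0 := by
  unfold jointCumulant
  rw [sum_setPartitions_insert hb]
  refine sum_eq_zero fun π hπ => ?_
  rw [mem_setPartitions] at hπ
  have h0 : ∅ ∉ π := fun h => by simpa using hπ.2.1 _ h
  have hpos : π.card ≠ 0 := by
    obtain ⟨a, ha⟩ := hH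
    obtain ⟨B, hB, -⟩ := hπ.2.2.2 a ha
    exact card_ne_zero_of_mem hB
  have hbn : ∀ B ∈ π, b ∉ B := fun B hB h => hb (hπ.1 B hB h)
  have hcard : ∀ C, (insert (insert b C) (π.erase C)).card = (π.erase C).card + 1 := fun C =>
    card_insert_of_notMem fun h => hbn _ (mem_of_mem_erase h) (mem_insert_self _ _)
  obtain ⟨k, hk⟩ := Nat.exists_eq_succ_of_ne_zero hpos
  rw [sum_insert h0, sum_congr rfl (g := fun _ => (-1 : A) ^ k * (k.factorial : A))]
  · rw [hcard, erase_eq_of_notMem h0, sum_const, hk]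
    simp only [Nat.succ_eq_add_one, Nat.add_sub_cancel, prod_const_one, mul_one, nsmul_eq_mul,
      Nat.factorial_succ]
    push_cast
    ring
  · intro C hC
    rw [hcard, card_erase_of_mem hC, hk]
    simp

/-- Merging two points `a` and `b`. -/
lemma sum_setPartitions_of_merge {α A : Type*} [CommRing A] {H : Finset α} {a b : α} (ha : a ∈ H)
    (hb : b ∉ H) (u : Finset α → A) :
    ∑ π ∈ setPartitions (insert b H), (if ∃ B ∈ π, a ∈ B ∧ b ∈ B then
      (-1 : A) ^ (π.card - 1) * ((π.card - 1).factorial : A) * ∏ B ∈ π, u B else 0) =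
    jointCumulant (fun B => u (if a ∈ B then insert b B else B)) H := by
  unfold jointCumulant
  rw [sum_setPartitions_insert hb]
  refine sum_congr rfl fun π hπ => ?_
  rw [mem_setPartitions] at hπ
  obtain ⟨h1, h2, h3, h4⟩ := hπ
  obtain ⟨D, hD, haD⟩ := h4 a ha
  have hbn : ∀ B ∈ π, b ∉ B := fun B hB h => hb (h1 B hB h)
  have hab : a ≠ b := fun h => hb (h ▸ ha)
  have hn : insert b D ∉ π.erase D := fun h => hbn _ (mem_of_mem_erase h) (mem_insert_self _ _)
  rw [sum_eq_single_of_mem D (mem_insert_of_mem hD)]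
  · rw [if_pos ⟨_, mem_insert_self _ _, mem_insert_of_mem haD, mem_insert_self _ _⟩,
      card_insert_of_notMem hn, card_erase_add_one hD, prod_insert hn, ← mul_prod_erase π _ hD,
      if_pos haD]
    congr 2
    refine prod_congr rfl fun B hB => ?_
    rw [if_neg]
    rw [mem_erase] at hB
    exact fun haB => disjoint_left.1 (h3 B hB.2 D hD hB.1) haB haD
  · intro C hC hCD
    rw [if_neg]
    rintro ⟨B, hB, haB, hbB⟩
    rcases mem_insert.1 hB with rfl | h
    · have haC := mem_of_mem_insert_of_ne haB hab
      rcases mem_insert.1 hC with rfl | h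
      · simp at haC
      · exact disjoint_left.1 (h3 C h D hD hCD) haC haD
    · exact hbn B (mem_of_mem_erase h) hbB

lemma prod_setPartition_ite {α A : Type*} [CommRing A] {H : Finset α} {π : Finset (Finset α)}
    (hπ : π ∈ setPartitions H) {a b : α} (ha : a ∈ H) (q : A) :
    ∏ B ∈ π, (if a ∈ B ∧ b ∈ B then q else 1) = if ∃ B ∈ π, a ∈ B ∧ b ∈ B then q else 1 := by
  rw [mem_setPartitions] at hπ
  obtain ⟨D, hD, haD⟩ := hπ.2.2.2 a ha
  have hu : ∀ B ∈ π, a ∈ B → B = D := fun B hB haB => by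
    by_contra hne
    exact disjoint_left.1 (hπ.2.2.1 B hB D hD hne) haB haD
  rw [prod_eq_single_of_mem D hD]
  · refine if_congr ⟨fun h => ⟨D, hD, h⟩, ?_⟩ rfl rfl
    rintro ⟨B, hB, h⟩
    exact hu B hB h.1 ▸ h
  · intro B hB hne
    rw [if_neg]
    exact fun h => hne (hu B hB h.1)

/-- Number of edges in the list `L` with both endpoints in `B`. -/
def edgeCount {α : Type*} (L : List (α × α)) (B : Finset α) : ℕ :=
  L.countP fun e => decide (e.1 ∈ B ∧ e.2 ∈ B)

/-- Deletion and contraction: the cumulant of `B ↦ q ^ #E(G|_B)` is `(q - 1) ^ (#H - 1)` times an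
element of any subsemiring containing `q`. -/
lemma jointCumulant_edgeCount {α A : Type*} [CommRing A] (R : Subsemiring A) {q : A} (hq : q ∈ R)
    (n : ℕ) : ∀ (L : List (α × α)) (H : Finset α), L.length = n → H.Nonempty →
      (∀ e ∈ L, e.1 ∈ H ∧ e.2 ∈ H) →
      ∃ P ∈ R, jointCumulant (fun B => q ^ edgeCount L B) H = (q - 1) ^ (H.card - 1) * P := by
  induction n with
  | zero =>
    intro L H hL hH _
    obtain rfl := List.length_eq_zero_iff.1 hL
    have h1 : (fun B : Finset α => q ^ edgeCount [] B) = fun _ => 1 := by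
      funext B
      simp [edgeCount]
    rw [h1]
    obtain ⟨b, hb⟩ := hH
    rcases (H.erase b).eq_empty_or_nonempty with h | h
    · rw [← insert_erase hb, h]
      refine ⟨1, R.one_mem, ?_⟩
      simp [jointCumulant, setPartitions_singleton]
    · rw [← insert_erase hb, jointCumulant_one_insert (notMem_erase b H) h]
      exact ⟨0, R.zero_mem, by simp⟩
  | succ n ih =>
    intro L H hL hH hLH
    match L, hL with
    | (a, b) :: L, hL =>
    replace hL : L.length = n := by simpa using hL
    obtain ⟨ha, hb⟩ := hLH (a, b) (by simp)
    simp only at ha hb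
    have hLH' : ∀ e ∈ L, e.1 ∈ H ∧ e.2 ∈ H := fun e he => hLH e (List.mem_cons_of_mem _ he)
    obtain ⟨P, hP, hPe⟩ := ih L H hL hH hLH'
    have hcons : ∀ B : Finset α, q ^ edgeCount ((a, b) :: L) B =
        q ^ edgeCount L B * if a ∈ B ∧ b ∈ B then q else 1 := by
      intro B
      simp only [edgeCount, List.countP_cons]
      split_ifs with h1 h2 h2
      · rw [pow_succ]
      · simp_all
      · simp_all
      · simp
    have hexp : jointCumulant (fun B => q ^ edgeCount ((a, b) :: L) B) H =
        jointCumulant (fun B => q ^ edgeCount L B) H + (q - 1) *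
          ∑ π ∈ setPartitions H, (if ∃ B ∈ π, a ∈ B ∧ b ∈ B then
            (-1 : A) ^ (π.card - 1) * ((π.card - 1).factorial : A) *
              ∏ B ∈ π, q ^ edgeCount L B else 0) := by
      unfold jointCumulant
      rw [mul_sum, ← sum_add_distrib]
      refine sum_congr rfl fun π hπ => ?_
      simp only [hcons]
      rw [prod_mul_distrib, prod_setPartition_ite hπ ha]
      split_ifs <;> ring
    by_cases hab : a = b
    · subst hab
      refine ⟨q * P, R.mul_mem hq hP, ?_⟩
      have : ∀ π ∈ setPartitions H, ∃ B ∈ π, a ∈ B ∧ a ∈ B := by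
        intro π hπ
        obtain ⟨B, hB, h⟩ := (mem_setPartitions.1 hπ).2.2.2 a ha
        exact ⟨B, hB, h, h⟩
      rw [hexp, sum_congr rfl fun π hπ => if_pos (this π hπ)]
      change _ + (q - 1) * jointCumulant (fun B => q ^ edgeCount L B) H = _
      rw [hPe]
      ring
    · have ha' : a ∈ H.erase b := mem_erase.2 ⟨hab, ha⟩
      let φ : α → α := fun x => if x = b then a else x
      have hφ : ∀ x ∈ H, φ x ∈ H.erase b := by
        intro x hx
        simp only [φ]
        split_ifs with h
        · exact ha'
        · exact mem_erase.2 ⟨h, hx⟩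
      obtain ⟨Q, hQ, hQe⟩ := ih (L.map fun e => (φ e.1, φ e.2)) (H.erase b) (by simpa using hL)
        ⟨a, ha'⟩ (by
          intro e he
          obtain ⟨e', he', rfl⟩ := List.mem_map.1 he
          exact ⟨hφ _ (hLH' e' he').1, hφ _ (hLH' e' he').2⟩)
      refine ⟨P + Q, R.add_mem hP hQ, ?_⟩
      have hmerge : ∀ B ⊆ H.erase b, edgeCount L (if a ∈ B then insert b B else B) =
          edgeCount (L.map fun e => (φ e.1, φ e.2)) B := by
        intro B hB
        have hbB : b ∉ B := fun h => notMem_erase b H (hB h)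
        have hx : ∀ x, x ∈ (if a ∈ B then insert b B else B) ↔ φ x ∈ B := by
          intro x
          simp only [φ]
          by_cases h : x = b <;> by_cases h' : a ∈ B <;> simp [h, h', hbB]
        simp only [edgeCount, List.countP_map, hx]
        rfl
      have hsum := sum_setPartitions_of_merge ha' (notMem_erase b H) fun B => q ^ edgeCount L B
      rw [insert_erase hb] at hsum
      rw [hexp, hsum, hPe]
      have : jointCumulant (fun B => q ^ edgeCount L (if a ∈ B then insert b B else B))
          (H.erase b) = (q - 1) ^ ((H.erase b).card - 1) * Q := by
        rw [← hQe]
        refine sum_congr rfl fun π hπ => ?_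
        congr 1
        refine prod_congr rfl fun B hB => ?_
        exact congrArg (q ^ ·) (hmerge B ((mem_setPartitions.1 hπ).1 B hB))
      rw [this]
      have hc : (H.erase b).card - 1 + 1 = H.card - 1 := by
        rw [card_erase_of_mem hb]
        have : 0 < (H.erase b).card := card_pos.2 ⟨a, ha'⟩
        rw [card_erase_of_mem hb] at this
        omega
      rw [← hc, pow_succ]
      ring


/-! ### Fillings of finite sets -/

/-- Maps `ι → ℕ` with values in `{1, …, N}` on `S` that vanish outside `S`. -/
def fillOn {ι : Type*} (S : Finset ι) (N : ℕ) : Finset (ι → ℕ) :=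
  (S.pi (fun _ => Finset.Icc 1 N)).image (fun g c => if h : c ∈ S then g c h else 0)

lemma fillings_eq_fillOn (f : ℕ → ℕ) (N : ℕ) : fillings f N = fillOn (cells f) N := by
  unfold fillings fillOn
  congr!

lemma mem_fillOn {ι : Type*} {S : Finset ι} {N : ℕ} {g : ι → ℕ} :
    g ∈ fillOn S N ↔ (∀ i ∈ S, g i ∈ Icc 1 N) ∧ ∀ i ∉ S, g i = 0 := by
  simp only [fillOn, mem_image, mem_pi]
  constructor
  · rintro ⟨h, hh, rfl⟩
    refine ⟨fun i hi => ?_, fun i hi => ?_⟩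
    · simpa only [dif_pos hi] using hh i hi
    · simp only [dif_neg hi]
  · rintro ⟨h1, h2⟩
    refine ⟨fun i _ => g i, h1, ?_⟩
    funext i
    split_ifs with hi
    · rfl
    · exact (h2 i hi).symm

/-- `g` restricted to `S` and extended by zero. -/
def restrictTo {ι : Type*} (S : Finset ι) (g : ι → ℕ) : ι → ℕ := fun i => if i ∈ S then g i else 0

lemma restrictTo_mem_fillOn {ι : Type*} {S T : Finset ι} (hST : S ⊆ T) {N : ℕ} {g : ι → ℕ}
    (hg : g ∈ fillOn T N) : restrictTo S g ∈ fillOn S N := by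
  rw [mem_fillOn] at hg ⊢
  refine ⟨fun i hi => ?_, fun i hi => if_neg hi⟩
  simpa only [restrictTo, if_pos hi] using hg.1 i (hST hi)

lemma sum_fillOn_union {ι A : Type*} [CommRing A] {S T : Finset ι} (hST : Disjoint S T) (N : ℕ)
    (F G : (ι → ℕ) → A) (hF : ∀ g g', (∀ i ∈ S, g i = g' i) → F g = F g')
    (hG : ∀ g g', (∀ i ∈ T, g i = g' i) → G g = G g') :
    (∑ g ∈ fillOn S N, F g) * ∑ g ∈ fillOn T N, G g = ∑ g ∈ fillOn (S ∪ T) N, F g * G g := by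
  rw [sum_mul_sum, ← sum_product']
  have hS : ∀ x ∈ fillOn S N ×ˢ fillOn T N, ∀ i ∈ S, (x.1 + x.2) i = x.1 i := by
    intro x hx i hi
    rw [mem_product] at hx
    simp [(mem_fillOn.1 hx.2).2 i (disjoint_left.1 hST hi)]
  have hT : ∀ x ∈ fillOn S N ×ˢ fillOn T N, ∀ i ∈ T, (x.1 + x.2) i = x.2 i := by
    intro x hx i hi
    rw [mem_product] at hx
    simp [(mem_fillOn.1 hx.1).2 i (disjoint_right.1 hST hi)]
  refine sum_bij' (fun x _ => x.1 + x.2) (fun g _ => (restrictTo S g, restrictTo T g))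
    ?_ ?_ ?_ ?_ ?_
  · intro x hx
    rw [mem_fillOn]
    have hx' := mem_product.1 hx
    rw [mem_fillOn, mem_fillOn] at hx'
    refine ⟨fun i hi => ?_, fun i hi => ?_⟩
    · rcases mem_union.1 hi with h | h
      · rw [hS x hx i h]
        exact hx'.1.1 i h
      · rw [hT x hx i h]
        exact hx'.2.1 i h
    · rw [mem_union, not_or] at hi
      simp [hx'.1.2 i hi.1, hx'.2.2 i hi.2]
  · intro g hg
    exact mem_product.2 ⟨restrictTo_mem_fillOn subset_union_left hg,
      restrictTo_mem_fillOn subset_union_right hg⟩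
  · intro x hx
    have hx' := mem_product.1 hx
    rw [mem_fillOn, mem_fillOn] at hx'
    refine Prod.ext ?_ ?_ <;> funext i <;> simp only [restrictTo] <;> split_ifs with h
    · exact hS x hx i h
    · exact (hx'.1.2 i h).symm
    · exact hT x hx i h
    · exact (hx'.2.2 i h).symm
  · intro g hg
    funext i
    simp only [restrictTo, Pi.add_apply]
    by_cases h : i ∈ S
    · simp [h, disjoint_left.1 hST h]
    · by_cases h' : i ∈ T
      · simp [h, h']
      · simp [h, h', (mem_fillOn.1 hg).2 i (by simp [h, h'])]
  · intro x hx
    rw [hF (x.1 + x.2) x.1 (hS x hx), hG (x.1 + x.2) x.2 (hT x hx)]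

lemma prod_sum_fillOn {ι β A : Type*} [DecidableEq β] [CommRing A] (S : Finset ι) (N : ℕ) (col : ι → β)
    (F : Finset β → (ι → ℕ) → A)
    (hF : ∀ B g g', (∀ i ∈ S, col i ∈ B → g i = g' i) → F B g = F B g')
    (π : Finset (Finset β)) (hπ : ∀ B ∈ π, ∀ C ∈ π, B ≠ C → Disjoint B C) :
    ∏ B ∈ π, ∑ g ∈ fillOn (S.filter fun i => col i ∈ B) N, F B g =
      ∑ g ∈ fillOn (S.filter fun i => ∃ B ∈ π, col i ∈ B) N, ∏ B ∈ π, F B g := by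
  induction π using Finset.induction_on with
  | empty =>
    have : fillOn (∅ : Finset ι) N = {fun _ => 0} := by
      ext g
      rw [mem_fillOn, mem_singleton, funext_iff]
      simp
    simp [this]
  | insert B π hB ih =>
    rw [prod_insert hB, ih fun C hC D hD =>
      hπ C (mem_insert_of_mem hC) D (mem_insert_of_mem hD), sum_fillOn_union]
    · have : (S.filter fun i => ∃ C ∈ insert B π, col i ∈ C) =
          (S.filter fun i => col i ∈ B) ∪ S.filter fun i => ∃ C ∈ π, col i ∈ C := by
        rw [← filter_or]
        refine filter_congr fun i _ => ?_
        simp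
      rw [this]
      exact sum_congr rfl fun g _ => (prod_insert (f := fun B => F B g) hB).symm
    · rw [disjoint_filter]
      rintro i - hi ⟨C, hC, hiC⟩
      have hne : B ≠ C := fun h => hB (h ▸ hC)
      exact disjoint_left.1 (hπ B (mem_insert_self _ _) C (mem_insert_of_mem hC) hne) hi hiC
    · intro g g' h
      exact hF B g g' fun i hi hiB => h i (mem_filter.2 ⟨hi, hiB⟩)
    · intro g g' h
      exact prod_congr rfl fun C hC => hF C g g' fun i hi hiC =>
        h i (mem_filter.2 ⟨hi, C, hC, hiC⟩)

lemma sum_fillOn_image {ι ι' A : Type*} [DecidableEq ι'] [AddCommMonoid A] {S : Finset ι} {θ : ι → ι'}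
    (hθ : Set.InjOn θ S) (N : ℕ) (F : (ι' → ℕ) → A) (G : (ι → ℕ) → A)
    (h : ∀ σ ∈ fillOn (S.image θ) N, F σ = G (restrictTo S (σ ∘ θ))) :
    ∑ σ ∈ fillOn (S.image θ) N, F σ = ∑ g ∈ fillOn S N, G g := by
  refine sum_bij (fun σ _ => restrictTo S (σ ∘ θ)) ?_ ?_ ?_ h
  · intro σ hσ
    rw [mem_fillOn] at hσ ⊢
    refine ⟨fun i hi => ?_, fun i hi => if_neg hi⟩
    simpa only [restrictTo, if_pos hi, Function.comp_apply] using hσ.1 _ (mem_image_of_mem _ hi)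
  · intro σ hσ σ' hσ' heq
    rw [mem_fillOn] at hσ hσ'
    funext x
    by_cases hx : x ∈ S.image θ
    · obtain ⟨i, hi, rfl⟩ := mem_image.1 hx
      have := congrFun heq i
      simpa only [restrictTo, if_pos hi, Function.comp_apply] using this
    · rw [hσ.2 x hx, hσ'.2 x hx]
  · intro g hg
    rw [mem_fillOn] at hg
    have hex : ∀ x, ∃ n, (∀ i ∈ S, θ i = x → n = g i) ∧ (x ∉ S.image θ → n = 0) := by
      intro x
      by_cases hx : x ∈ S.image θ
      · obtain ⟨i, hi, rfl⟩ := mem_image.1 hx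
        exact ⟨g i, fun k hk hki => by rw [hθ hk hi hki], fun h => absurd hx h⟩
      · exact ⟨0, fun i hi hix => absurd (mem_image.2 ⟨i, hi, hix⟩) hx, fun _ => rfl⟩
    choose σ hσ1 hσ2 using hex
    have hσ : ∀ i ∈ S, σ (θ i) = g i := fun i hi => hσ1 _ i hi rfl
    refine ⟨σ, ?_, ?_⟩
    · rw [mem_fillOn]
      refine ⟨fun x hx => ?_, hσ2⟩
      obtain ⟨i, hi, rfl⟩ := mem_image.1 hx
      rw [hσ i hi]
      exact hg.1 i hi
    · funext i
      by_cases hi : i ∈ S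
      · simp only [restrictTo, if_pos hi, Function.comp_apply, hσ i hi]
      · simp only [restrictTo, if_neg hi, hg.2 i hi]

/-! ### Haglund's formula for sets of columns -/

/-- The boxes `(c, j)`, `1 ≤ j ≤ ht c`, of the columns in `K`. -/
def colCells {κ : Type*} (ht : κ → ℕ) (K : Finset κ) : Finset (κ × ℕ) :=
  K.biUnion fun c => (Icc 1 (ht c)).image fun j => (c, j)

lemma mem_colCells {κ : Type*} {ht : κ → ℕ} {K : Finset κ} {p : κ × ℕ} :
    p ∈ colCells ht K ↔ p.1 ∈ K ∧ 1 ≤ p.2 ∧ p.2 ≤ ht p.1 := by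
  obtain ⟨c, j⟩ := p
  simp only [colCells, mem_biUnion, mem_image, mem_Icc, Prod.mk.injEq]
  constructor
  · rintro ⟨c, hc, j, hj, rfl, rfl⟩
    exact ⟨hc, hj⟩
  · rintro ⟨hc, hj⟩
    exact ⟨c, hc, j, hj, rfl, rfl⟩

/-- The entry below the box `p`, or `0` in the bottom row. -/
def below {κ : Type*} (g : κ × ℕ → ℕ) (p : κ × ℕ) : ℕ := if 2 ≤ p.2 then g (p.1, p.2 - 1) else 0

/-- Inversion pairs of a filling of the columns in `K`. -/
def colInv {κ : Type*} [LinearOrder κ] (ht : κ → ℕ) (K : Finset κ) (g : κ × ℕ → ℕ) :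
    Finset ((κ × ℕ) × (κ × ℕ)) :=
  (colCells ht K ×ˢ colCells ht K).filter fun p =>
    p.1.2 = p.2.2 ∧ p.1.1 < p.2.1 ∧
      ((g p.1 ≤ below g p.1 ∧ below g p.1 < g p.2) ∨ (below g p.1 < g p.2 ∧ g p.2 < g p.1) ∨
        (g p.2 < g p.1 ∧ g p.1 ≤ below g p.1))

/-- The contribution of one box to `t^{maj} x^σ`. -/
def boxWeight {κ : Type*} (ht : κ → ℕ) (g : κ × ℕ → ℕ) (p : κ × ℕ) : MR :=
  tv ^ (if 2 ≤ p.2 ∧ below g p < g p then ht p.1 - p.2 + 1 else 0) * xv (g p)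

/-- The weight of a filling of the columns in `K`. -/
def colWeight {κ : Type*} [LinearOrder κ] (ht : κ → ℕ) (K : Finset κ) (g : κ × ℕ → ℕ) : MR :=
  qv ^ (colInv ht K g).card * ∏ p ∈ colCells ht K, boxWeight ht g p

lemma below_congr {κ : Type*} {ht : κ → ℕ} {K : Finset κ} {g g' : κ × ℕ → ℕ}
    (h : ∀ p ∈ colCells ht K, g p = g' p) {p : κ × ℕ} (hp : p ∈ colCells ht K) :
    below g p = below g' p := by
  simp only [below]
  split_ifs with h2
  · apply h
    rw [mem_colCells] at hp ⊢
    exact ⟨hp.1, by simp only; omega, by simp only; omega⟩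
  · rfl

lemma colWeight_congr {κ : Type*} [LinearOrder κ] {ht : κ → ℕ} {K : Finset κ} {g g' : κ × ℕ → ℕ}
    (h : ∀ p ∈ colCells ht K, g p = g' p) : colWeight ht K g = colWeight ht K g' := by
  have hi : colInv ht K g = colInv ht K g' := by
    refine filter_congr fun p hp => ?_
    rw [mem_product] at hp
    rw [h _ hp.1, h _ hp.2, below_congr h hp.1]
  simp only [colWeight, hi]
  congr 1
  refine prod_congr rfl fun p hp => ?_
  simp only [boxWeight, h p hp, below_congr h hp]

section Columns

variable {κ : Type*} [LinearOrder κ]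

/-- The position of the column `c` among the columns in `K`. -/
def colPos (K : Finset κ) (c : κ) : ℕ := (K.filter fun c' => c' ≤ c).card

lemma colPos_lt {K : Finset κ} {c c' : κ} (hc' : c' ∈ K) (h : c < c') :
    colPos K c < colPos K c' := by
  refine card_lt_card (ssubset_iff_of_subset ?_ |>.2 ⟨c', ?_, ?_⟩)
  · exact fun x hx => mem_filter.2 ⟨(mem_filter.1 hx).1, (mem_filter.1 hx).2.trans h.le⟩
  · exact mem_filter.2 ⟨hc', le_rfl⟩
  · exact fun hx => not_le_of_gt h (mem_filter.1 hx).2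

lemma colPos_lt_iff {K : Finset κ} {c c' : κ} (hc : c ∈ K) (hc' : c' ∈ K) :
    colPos K c < colPos K c' ↔ c < c' := by
  refine ⟨fun h => ?_, colPos_lt hc'⟩
  by_contra hn
  rcases (not_lt.1 hn).lt_or_eq with h' | rfl
  · exact (colPos_lt hc h').asymm h
  · exact lt_irrefl _ h

lemma colPos_injOn (K : Finset κ) : Set.InjOn (colPos K) K := by
  intro c hc c' hc' h
  rcases lt_trichotomy c c' with h' | h' | h'
  · exact absurd h (colPos_lt hc' h').ne
  · exact h'
  · exact absurd h (colPos_lt hc h').ne'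

lemma one_le_colPos {K : Finset κ} {c : κ} (hc : c ∈ K) : 1 ≤ colPos K c :=
  card_pos.2 ⟨c, mem_filter.2 ⟨hc, le_rfl⟩⟩

lemma exists_colPos_eq {K : Finset κ} {x : ℕ} (h1 : 1 ≤ x) (h2 : x ≤ K.card) :
    ∃ c ∈ K, colPos K c = x := by
  have : K.image (colPos K) = Icc 1 K.card := by
    refine eq_of_subset_of_card_le ?_ ?_
    · intro y hy
      obtain ⟨c, hc, rfl⟩ := mem_image.1 hy
      exact mem_Icc.2 ⟨one_le_colPos hc, card_filter_le _ _⟩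
    · rw [card_image_of_injOn (colPos_injOn K)]
      simp
  exact mem_image.1 (this ▸ mem_Icc.2 ⟨h1, h2⟩)

lemma colPos_le_iff {ht : κ → ℕ} (hanti : Antitone ht) {K : Finset κ} {c : κ} (hc : c ∈ K)
    (j : ℕ) : colPos K c ≤ (K.filter fun c => j ≤ ht c).card ↔ j ≤ ht c := by
  constructor
  · intro h
    by_contra hn
    refine absurd h (not_le_of_gt (card_lt_card (ssubset_iff_of_subset ?_ |>.2 ⟨c, ?_, ?_⟩)))
    · intro x hx
      rw [mem_filter] at hx ⊢
      refine ⟨hx.1, ?_⟩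
      by_contra hxc
      exact hn (hx.2.trans (hanti (not_le.1 hxc).le))
    · exact mem_filter.2 ⟨hc, le_rfl⟩
    · exact fun hx => hn (mem_filter.1 hx).2
  · intro h
    refine card_le_card fun x hx => ?_
    rw [mem_filter] at hx ⊢
    exact ⟨hx.1, h.trans (hanti hx.2)⟩

lemma le_nRows {f : ℕ → ℕ} (hb : BddAbove {j | f j ≠ 0}) {j : ℕ} (h : f j ≠ 0) : j ≤ nRows f :=
  le_csSup hb h

/-- Haglund's formula, in terms of fillings of a set of columns ordered by decreasing height. -/
lemma macH_eq_sum_colWeight {ht : κ → ℕ} (hanti : Antitone ht) (K : Finset κ) {f : ℕ → ℕ}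
    (hf : ∀ j, 1 ≤ j → f j = (K.filter fun c => j ≤ ht c).card) (N : ℕ) :
    macH f N = ∑ g ∈ fillOn (colCells ht K) N, colWeight ht K g := by
  have hpos : ∀ c ∈ K, ∀ j, 1 ≤ j → (colPos K c ≤ f j ↔ j ≤ ht c) := fun c hc j hj => by
    rw [hf j hj, colPos_le_iff hanti hc]
  have hbdd : BddAbove {j | f j ≠ 0} := by
    refine ⟨K.sup ht, fun j hj => ?_⟩
    by_contra hn
    rcases Nat.eq_zero_or_pos j with rfl | hj1
    · simp at hn
    · refine hj ?_
      rw [hf j hj1, card_eq_zero, filter_eq_empty_iff]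
      intro c hc hjc
      exact hn (hjc.trans (le_sup hc))
  let θ : κ × ℕ → ℕ × ℕ := fun p => (colPos K p.1, p.2)
  have hθ : Set.InjOn θ (colCells ht K) := by
    rintro ⟨c, j⟩ hp ⟨c', j'⟩ hp' h
    simp only [mem_coe, mem_colCells] at hp hp'
    simp only [θ, Prod.mk.injEq] at h ⊢
    exact ⟨colPos_injOn K hp.1 hp'.1 h.1, h.2⟩
  have hcells : cells f = (colCells ht K).image θ := by
    ext ⟨x, j⟩
    simp only [cells, mem_filter, mem_product, mem_Icc, mem_image, θ, Prod.mk.injEq]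
    constructor
    · rintro ⟨⟨⟨hx1, -⟩, hj1, -⟩, hxj⟩
      have hxK : x ≤ K.card := hxj.trans (hf j hj1 ▸ card_filter_le _ _)
      obtain ⟨c, hc, rfl⟩ := exists_colPos_eq hx1 hxK
      exact ⟨(c, j), mem_colCells.2 ⟨hc, hj1, (hpos c hc j hj1).1 hxj⟩, rfl, rfl⟩
    · rintro ⟨⟨c, j⟩, hp, rfl, rfl⟩
      rw [mem_colCells] at hp
      obtain ⟨hc, hj1, hj⟩ := hp
      simp only at hc hj1 hj ⊢
      have h1 := one_le_colPos hc
      have hle := (hpos c hc j hj1).2 hj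
      exact ⟨⟨⟨h1, (hpos c hc 1 le_rfl).2 (hj1.trans hj)⟩, hj1, le_nRows hbdd (by omega)⟩, hle⟩
  have hcolLen : ∀ p ∈ colCells ht K, colLen f (colPos K p.1) = ht p.1 := by
    intro p hp
    rw [mem_colCells] at hp
    have : (Icc 1 (nRows f)).filter (fun j => colPos K p.1 ≤ f j) = Icc 1 (ht p.1) := by
      ext j
      simp only [mem_filter, mem_Icc]
      constructor
      · rintro ⟨⟨h1, -⟩, h2⟩
        exact ⟨h1, (hpos _ hp.1 j h1).1 h2⟩
      · rintro ⟨h1, h2⟩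
        have h3 := (hpos _ hp.1 j h1).2 h2
        have := one_le_colPos hp.1
        exact ⟨⟨h1, le_nRows hbdd (by omega)⟩, h3⟩
    rw [colLen, this]
    simp
  rw [macH, fillings_eq_fillOn, hcells]
  refine sum_fillOn_image (A := MR) hθ N _ _ fun σ hσ => ?_
  rw [← hcells] at hσ ⊢
  have hσ0 := (mem_fillOn.1 hσ).2
  set g := restrictTo (colCells ht K) (σ ∘ θ) with hg
  have hgσ : ∀ p ∈ colCells ht K, g p = σ (θ p) := fun p hp => by simp [hg, restrictTo, hp]
  have hbelow : ∀ p ∈ colCells ht K, below g p = σ ((θ p).1, (θ p).2 - 1) := by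
    intro p hp
    have hp' := mem_colCells.1 hp
    simp only [below]
    split_ifs with h2
    · rw [hgσ]
      rw [mem_colCells]
      exact ⟨hp'.1, by simp only; omega, by simp only; omega⟩
    · refine (hσ0 _ fun h => ?_).symm
      simp only [cells, mem_filter, mem_product, mem_Icc, θ] at h
      omega
  have hinv : (invPairs f σ) = (colInv ht K g).image (Prod.map θ θ) := by
    ext ⟨a, b⟩
    simp only [invPairs, colInv, mem_filter, mem_product, mem_image, Prod.exists, Prod.map_apply,
      Prod.mk.injEq]
    rw [hcells]
    constructor
    · rintro ⟨⟨ha, hb⟩, hrow, hlt, htr⟩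
      obtain ⟨p, hp, rfl⟩ := mem_image.1 ha
      obtain ⟨p', hp', rfl⟩ := mem_image.1 hb
      refine ⟨p.1, p.2, p'.1, p'.2, ⟨⟨hp, hp'⟩, hrow, ?_, ?_⟩, rfl, rfl⟩
      · exact (colPos_lt_iff (mem_colCells.1 hp).1 (mem_colCells.1 hp').1).1 hlt
      · rw [hbelow _ hp, hgσ _ hp, hgσ _ hp']
        exact htr
    · rintro ⟨c, j, c', j', ⟨⟨hp, hp'⟩, hrow, hlt, htr⟩, rfl, rfl⟩
      refine ⟨⟨mem_image_of_mem _ hp, mem_image_of_mem _ hp'⟩, hrow, ?_, ?_⟩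
      · exact (colPos_lt_iff (mem_colCells.1 hp).1 (mem_colCells.1 hp').1).2 hlt
      · rw [hbelow _ hp, hgσ _ hp, hgσ _ hp'] at htr
        exact htr
  have hinvcard : invStat f σ = (colInv ht K g).card := by
    rw [invStat, hinv]
    refine card_image_of_injOn ?_
    rintro ⟨a, b⟩ h ⟨a', b'⟩ h' heq
    simp only [mem_coe, colInv, mem_filter, mem_product] at h h'
    simp only [Prod.map_apply, Prod.mk.injEq] at heq ⊢
    exact ⟨hθ h.1.1 h'.1.1 heq.1, hθ h.1.2 h'.1.2 heq.2⟩
  have hmaj : majStat f σ = ∑ p ∈ colCells ht K,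
      if 2 ≤ p.2 ∧ below g p < g p then ht p.1 - p.2 + 1 else 0 := by
    rw [majStat, desSet, sum_filter, hcells, sum_image hθ]
    refine sum_congr rfl fun p hp => ?_
    rw [hbelow p hp, hgσ p hp, hcolLen p hp]
  rw [hinvcard, hmaj, hcells, prod_image hθ, colWeight, mul_assoc]
  congr 1
  simp only [boxWeight]
  rw [prod_mul_distrib, prod_pow_eq_pow_sum]
  congr 1
  exact prod_congr rfl fun p hp => by rw [hgσ p hp]

end Columns

/-! ### The columns of the diagrams `λ^B` -/

/-- Column labels `(height, color, index)`, ordered by decreasing height, then by color, then by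
index. -/
abbrev ColLabel (r : ℕ) : Type := ℕᵒᵈ ×ₗ (Fin (r + 1) ×ₗ ℕ)

/-- The height of a labelled column. -/
def labelHeight {r : ℕ} (c : ColLabel r) : ℕ := OrderDual.ofDual (ofLex c).1

/-- The color of a labelled column. -/
def labelColor {r : ℕ} (c : ColLabel r) : Fin (r + 1) := (ofLex (ofLex c).2).1

lemma labelHeight_antitone {r : ℕ} : Antitone (labelHeight (r := r)) := by
  intro c c' h
  rcases Prod.Lex.le_iff.1 h with h | h
  · exact (OrderDual.ofDual_lt_ofDual.2 h).le
  · exact (congrArg OrderDual.ofDual h.1).ge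

/-- The label of the column `i` of `λ^b`. -/
def columnLabel {r : ℕ} (lam : Fin (r + 1) → ℕ → ℕ) (p : (_ : Fin (r + 1)) × ℕ) : ColLabel r :=
  toLex (OrderDual.toDual (colLen (lam p.1) p.2), toLex (p.1, p.2))

/-- The labels of all columns of the diagrams `λ^b`. -/
def columnLabels {r : ℕ} (lam : Fin (r + 1) → ℕ → ℕ) : Finset (ColLabel r) :=
  (univ.sigma fun b => Icc 1 (lam b 1)).image (columnLabel lam)

lemma le_colLen_iff {f : ℕ → ℕ} (hf : IsPartitionFun f) {i j : ℕ} (hi : 1 ≤ i) (hj : 1 ≤ j) :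
    j ≤ colLen f i ↔ i ≤ f j := by
  obtain ⟨hanti, n, hn⟩ := hf
  have hbdd : BddAbove {j | f j ≠ 0} := by
    refine ⟨n, fun k hk => ?_⟩
    by_contra hlt
    have := hanti (not_le.1 hlt).le
    exact hk (by omega)
  constructor
  · intro h
    by_contra hn
    have hsub : (Icc 1 (nRows f)).filter (fun j => i ≤ f j) ⊆ Icc 1 (j - 1) := by
      intro k hk
      rw [mem_filter, mem_Icc] at hk
      rw [mem_Icc]
      refine ⟨hk.1.1, ?_⟩
      by_contra hkj
      have := hanti (show j ≤ k by omega)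
      omega
    have := card_le_card hsub
    rw [Nat.card_Icc] at this
    rw [colLen] at h
    omega
  · intro h
    have hsub : Icc 1 j ⊆ (Icc 1 (nRows f)).filter fun j => i ≤ f j := by
      intro k hk
      rw [mem_Icc] at hk
      have := hanti hk.2
      rw [mem_filter, mem_Icc]
      exact ⟨⟨hk.1, le_nRows hbdd (by omega)⟩, by omega⟩
    have := card_le_card hsub
    rw [Nat.card_Icc] at this
    rw [colLen]
    omega

lemma lamB_eq_card {r : ℕ} {lam : Fin (r + 1) → ℕ → ℕ} (hlam : ∀ b, IsPartitionFun (lam b))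
    (B : Finset (Fin (r + 1))) {j : ℕ} (hj : 1 ≤ j) :
    lamB lam B j =
      (((columnLabels lam).filter fun c => labelColor c ∈ B).filter
        fun c => j ≤ labelHeight c).card := by
  have hinj : Function.Injective (columnLabel lam) := by
    rintro ⟨b, i⟩ ⟨b', i'⟩ h
    have h2 : (b, i) = (b', i') := congrArg (fun c => ofLex (ofLex c).2) h
    simp only [Prod.mk.injEq] at h2
    rw [h2.1, h2.2]
  have : ((columnLabels lam).filter fun c => labelColor c ∈ B).filter
      (fun c => j ≤ labelHeight c) = (B.sigma fun b => Icc 1 (lam b j)).image (columnLabel lam) := by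
    ext c
    simp only [columnLabels, mem_filter, mem_image, mem_sigma, mem_univ, true_and, mem_Icc]
    constructor
    · rintro ⟨⟨⟨p, hp, rfl⟩, hB⟩, hh⟩
      exact ⟨p, ⟨hB, hp.1, (le_colLen_iff (hlam p.1) hp.1 hj).1 hh⟩, rfl⟩
    · rintro ⟨p, ⟨hB, h1, h2⟩, rfl⟩
      exact ⟨⟨⟨p, ⟨h1, h2.trans ((hlam p.1).1 hj)⟩, rfl⟩, hB⟩,
        (le_colLen_iff (hlam p.1) h1 hj).2 h2⟩
  rw [this, card_image_of_injective _ hinj, card_sigma, lamB]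
  simp

lemma colCells_filter {r : ℕ} (K : Finset (ColLabel r)) (B : Finset (Fin (r + 1))) :
    colCells labelHeight (K.filter fun c => labelColor c ∈ B) =
      (colCells labelHeight K).filter fun p => labelColor p.1 ∈ B := by
  ext p
  simp only [mem_colCells, mem_filter]
  tauto

/-- The colored inversion pairs of a filling, as the edges of a multigraph on the colors. -/
def inversionEdges {r : ℕ} (K : Finset (ColLabel r)) (g : ColLabel r × ℕ → ℕ) :
    List (Fin (r + 1) × Fin (r + 1)) :=
  (colInv labelHeight K g).toList.map fun p => (labelColor p.1.1, labelColor p.2.1)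

lemma card_colInv_filter {r : ℕ} (K : Finset (ColLabel r)) (g : ColLabel r × ℕ → ℕ)
    (B : Finset (Fin (r + 1))) :
    (colInv labelHeight (K.filter fun c => labelColor c ∈ B) g).card =
      edgeCount (inversionEdges K g) B := by
  have : colInv labelHeight (K.filter fun c => labelColor c ∈ B) g =
      (colInv labelHeight K g).filter fun p => labelColor p.1.1 ∈ B ∧ labelColor p.2.1 ∈ B := by
    ext p
    simp only [colInv, colCells_filter, mem_filter, mem_product]
    tauto
  rw [this, edgeCount, inversionEdges, List.countP_map, List.countP_eq_length_filter, card_def,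
    filter_val, ← coe_toList, Multiset.filter_coe, Multiset.coe_card]
  congr!
  simp only [Function.comp_apply]
  congr!

/-- The product over a set partition of the blockwise weights of a filling. -/
lemma prod_colWeight {r : ℕ} (K : Finset (ColLabel r)) (g : ColLabel r × ℕ → ℕ)
    {π : Finset (Finset (Fin (r + 1)))} (hπ : π ∈ setPartitions univ) :
    ∏ B ∈ π, colWeight labelHeight (K.filter fun c => labelColor c ∈ B) g =
      (∏ p ∈ colCells labelHeight K, boxWeight labelHeight g p) *
        ∏ B ∈ π, qv ^ edgeCount (inversionEdges K g) B := by
  rw [mem_setPartitions] at hπ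
  simp only [colWeight]
  rw [prod_mul_distrib, mul_comm]
  congr 1
  · simp only [colCells_filter]
    rw [← prod_biUnion]
    · congr 1
      ext p
      simp only [mem_biUnion, mem_filter]
      constructor
      · rintro ⟨B, -, hp, -⟩
        exact hp
      · intro hp
        obtain ⟨B, hB, h⟩ := hπ.2.2.2 (labelColor p.1) (mem_univ _)
        exact ⟨B, hB, hp, h⟩
    · intro B hB C hC hne
      rw [Function.onFun, disjoint_filter]
      exact fun p _ h h' => disjoint_left.1 (hπ.2.2.1 B hB C hC hne) h h'
  · simp only [card_colInv_filter]

lemma prod_macH {r : ℕ} (N : ℕ) {lam : Fin (r + 1) → ℕ → ℕ} (hlam : ∀ b, IsPartitionFun (lam b))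
    {π : Finset (Finset (Fin (r + 1)))} (hπ : π ∈ setPartitions univ) :
    ∏ B ∈ π, macH (lamB lam B) N =
      ∑ g ∈ fillOn (colCells labelHeight (columnLabels lam)) N,
        (∏ p ∈ colCells labelHeight (columnLabels lam), boxWeight labelHeight g p) *
          ∏ B ∈ π, qv ^ edgeCount (inversionEdges (columnLabels lam) g) B := by
  have hπ' := mem_setPartitions.1 hπ
  have hB : ∀ B, macH (lamB lam B) N =
      ∑ g ∈ fillOn ((colCells labelHeight (columnLabels lam)).filter
        fun p => labelColor p.1 ∈ B) N,
        colWeight labelHeight ((columnLabels lam).filter fun c => labelColor c ∈ B) g := by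
    intro B
    rw [← colCells_filter]
    exact macH_eq_sum_colWeight labelHeight_antitone _ (fun j hj => lamB_eq_card hlam B hj) N
  simp only [hB]
  rw [prod_sum_fillOn _ N (fun p => labelColor p.1)
    (fun B g => colWeight labelHeight ((columnLabels lam).filter fun c => labelColor c ∈ B) g)
    _ π hπ'.2.2.1]
  · rw [filter_true_of_mem fun p _ => hπ'.2.2.2 (labelColor p.1) (mem_univ _)]
    exact sum_congr rfl fun g _ => prod_colWeight _ g hπ
  · intro B g g' h
    refine colWeight_congr fun p hp => ?_
    rw [colCells_filter, mem_filter] at hp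
    exact h p hp.1 hp.2

/-- The cumulant is a sum over fillings of cumulants of multigraphs. -/
lemma macCumulant_eq_sum {r : ℕ} (N : ℕ) {lam : Fin (r + 1) → ℕ → ℕ}
    (hlam : ∀ b, IsPartitionFun (lam b)) :
    macCumulant lam N =
      ∑ g ∈ fillOn (colCells labelHeight (columnLabels lam)) N,
        (∏ p ∈ colCells labelHeight (columnLabels lam), boxWeight labelHeight g p) *
          jointCumulant (fun B => qv ^ edgeCount (inversionEdges (columnLabels lam) g) B) univ := by
  simp only [macCumulant, jointCumulant, mul_sum]
  rw [sum_comm]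
  refine sum_congr rfl fun π hπ => ?_
  rw [prod_macH N hlam hπ, mul_sum]
  exact sum_congr rfl fun g _ => by ring

/-- The polynomials with nonnegative coefficients. -/
def nonnegPolys : Subsemiring MR := (MvPolynomial.map (Nat.castRingHom ℤ)).rangeS

lemma X_mem_nonnegPolys (i : Fin 2 ⊕ ℕ) : MvPolynomial.X i ∈ nonnegPolys :=
  ⟨MvPolynomial.X i, MvPolynomial.map_X _ _⟩

lemma coeff_nonneg_of_mem {P : MR} (hP : P ∈ nonnegPolys) (m : (Fin 2 ⊕ ℕ) →₀ ℕ) :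
    0 ≤ MvPolynomial.coeff m P := by
  obtain ⟨Q, rfl⟩ := hP
  rw [MvPolynomial.coeff_map]
  exact Int.natCast_nonneg _

/-- **Theorem 1.4, in `N` variables, with monomial positivity.** The Macdonald cumulant
`Σ_{π ∈ 𝒫([r])} (-1)^{#π-1}(#π-1)! Π_{B∈π} H̃_{λ^B}` is divisible by `(q-1)^{#[r]-1}`
in `ℤ[q,t,x]`, and the quotient has nonnegative integer coefficients. -/
theorem stmt8 (r N : ℕ) (hN : 1 ≤ N) (lam : Fin (r+1) → ℕ → ℕ)
    (hlam : ∀ b, IsPartitionFun (lam b)) :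
    ∃ P : MR, macCumulant lam N = (qv - 1) ^ r * P ∧
      ∀ m : (Fin 2 ⊕ ℕ) →₀ ℕ, 0 ≤ MvPolynomial.coeff m P := by
  have h := fun g : ColLabel r × ℕ → ℕ =>
    jointCumulant_edgeCount nonnegPolys (X_mem_nonnegPolys (Sum.inl 0)) _
      (inversionEdges (columnLabels lam) g) univ rfl univ_nonempty
      fun e _ => ⟨mem_univ e.1, mem_univ e.2⟩
  choose P hP hPe using h
  refine ⟨∑ g ∈ fillOn (colCells labelHeight (columnLabels lam)) N,
    (∏ p ∈ colCells labelHeight (columnLabels lam), boxWeight labelHeight g p) * P g, ?_, ?_⟩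
  · rw [macCumulant_eq_sum N hlam, mul_sum]
    refine sum_congr rfl fun g _ => ?_
    have hg := hPe g
    rw [card_univ, Fintype.card_fin, Nat.add_sub_cancel] at hg
    change jointCumulant (fun B => qv ^ _) univ = (qv - 1) ^ r * P g at hg
    rw [hg]
    ring
  · refine coeff_nonneg_of_mem (sum_mem fun g _ => mul_mem (prod_mem fun p _ => ?_) (hP g))
    exact mul_mem (pow_mem (X_mem_nonnegPolys _) _) (X_mem_nonnegPolys _)

end
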